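/- Let q be a prime power and let n, k₁, k₂, t be positive integers with n ≥ k₁ + k₂ + t + 3 and k₁ > k₂ ≥ t + 1. Then for every S ∈ M(t+1,n): |A₃(S;k₁)|·|A₄(S;k₂,t)| > |A₃(S;k₂)|·|A₄(S;k₁,t)|. -/

import Mathlib

open Module Set

/-- Gaussian binomial coefficient `[n k]_q`, as a rational number, via the
product formula `∏_{0 ≤ i < k} (q^{n-i} - 1)/(q^{k-i} - 1)`. -/
noncomputable def gaussQ (q n k : ℕ) : ℚ :=
  ∏ i ∈ Finset.range k, ((q : ℚ) ^ (n - i) - 1) / ((q : ℚ) ^ (k - i) - 1)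

/-- `A` is a `k`-flat of the affine space `AG(n, q)` (with `q = |𝔽|`):
a coset `x + P` of a `k`-dimensional linear subspace `P` of `𝔽^n`. -/
def IsFlat (𝔽 : Type) [Field 𝔽] {n : ℕ} (k : ℕ) (A : Set (Fin n → 𝔽)) : Prop :=
  ∃ (P : Submodule 𝔽 (Fin n → 𝔽)) (x : Fin n → 𝔽),
    Module.finrank 𝔽 ↥P = k ∧ A = {v | v - x ∈ P}

/-- `A` is a flat (in particular nonempty) of dimension at least `t`. -/
def DimGe (𝔽 : Type) [Field 𝔽] {n : ℕ} (t : ℕ) (A : Set (Fin n → 𝔽)) : Prop :=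
  ∃ j, t ≤ j ∧ IsFlat 𝔽 j A

/-- Two families of flats are cross `t`-intersecting. -/
def CrossT (𝔽 : Type) [Field 𝔽] {n : ℕ} (t : ℕ)
    (F1 F2 : Set (Set (Fin n → 𝔽))) : Prop :=
  ∀ A ∈ F1, ∀ B ∈ F2, DimGe 𝔽 t (A ∩ B)

/-- A pair of families is trivial: some `t`-flat is contained in every member. -/
def TrivialPair (𝔽 : Type) [Field 𝔽] {n : ℕ} (t : ℕ)
    (F1 F2 : Set (Set (Fin n → 𝔽))) : Prop :=
  ∃ T : Set (Fin n → 𝔽), IsFlat 𝔽 t T ∧ (∀ A ∈ F1, T ⊆ A) ∧ (∀ B ∈ F2, T ⊆ B)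

/-- `T` is a `t`-cover of the family `F`: `dim (T ∩ A) ≥ t` for all `A ∈ F`. -/
def IsTCover (𝔽 : Type) [Field 𝔽] {n : ℕ} (t : ℕ) (T : Set (Fin n → 𝔽))
    (F : Set (Set (Fin n → 𝔽))) : Prop :=
  ∀ A ∈ F, DimGe 𝔽 t (T ∩ A)

/-- `τ_t(F)`: the minimum dimension of a `t`-cover of `F`. -/
noncomputable def tauT (𝔽 : Type) [Field 𝔽] {n : ℕ} (t : ℕ)
    (F : Set (Set (Fin n → 𝔽))) : ℕ :=
  sInf {x | ∃ T : Set (Fin n → 𝔽), IsFlat 𝔽 x T ∧ IsTCover 𝔽 t T F}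

/-- `A₁(M, T; k, t) = {F ∈ M(k,n) : T ⊆ F, dim(F ∩ M) ≥ t + 1}`. -/
def A1 (𝔽 : Type) [Field 𝔽] {n : ℕ} (M T : Set (Fin n → 𝔽)) (k t : ℕ) :
    Set (Set (Fin n → 𝔽)) :=
  {F | IsFlat 𝔽 k F ∧ T ⊆ F ∧ DimGe 𝔽 (t + 1) (F ∩ M)}

/-- `A₂(M, T; k, t) = {F ∈ M(k,n) : T ⊆ F} ∪ {F ∈ M(k,n) : F ⊆ M, dim(F ∩ T) = t - 1}`. -/
def A2 (𝔽 : Type) [Field 𝔽] {n : ℕ} (M T : Set (Fin n → 𝔽)) (k t : ℕ) :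
    Set (Set (Fin n → 𝔽)) :=
  {F | IsFlat 𝔽 k F ∧ T ⊆ F} ∪ {F | IsFlat 𝔽 k F ∧ F ⊆ M ∧ IsFlat 𝔽 (t - 1) (F ∩ T)}

/-- `A₃(S; k) = {F ∈ M(k,n) : S ⊆ F}`. -/
def A3 (𝔽 : Type) [Field 𝔽] {n : ℕ} (S : Set (Fin n → 𝔽)) (k : ℕ) :
    Set (Set (Fin n → 𝔽)) :=
  {F | IsFlat 𝔽 k F ∧ S ⊆ F}

/-- `A₄(S; k, t) = {F ∈ M(k,n) : dim(F ∩ S) ≥ t}`. -/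
def A4 (𝔽 : Type) [Field 𝔽] {n : ℕ} (S : Set (Fin n → 𝔽)) (k t : ℕ) :
    Set (Set (Fin n → 𝔽)) :=
  {F | IsFlat 𝔽 k F ∧ DimGe 𝔽 t (F ∩ S)}

section Subspaces

variable {K V : Type*} [Field K] [AddCommGroup V] [Module K V]

/-- The subspaces of dimension `k` containing `P`. -/
def superspaces (P : Submodule K V) (k : ℕ) : Set (Submodule K V) :=
  {W | P ≤ W ∧ Module.finrank K W = k}

theorem mem_superspaces {P W : Submodule K V} {k : ℕ} :
    W ∈ superspaces P k ↔ P ≤ W ∧ Module.finrank K W = k := Iff.rfl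

theorem superspaces_nonempty [FiniteDimensional K V] (P : Submodule K V) {k : ℕ}
    (hP : Module.finrank K P ≤ k) (hk : k ≤ Module.finrank K V) :
    (superspaces P k).Nonempty := by
  induction k, hP using Nat.le_induction with
  | base => exact ⟨P, le_rfl, rfl⟩
  | succ k _ ih =>
    obtain ⟨W, hPW, hW⟩ := ih (by omega)
    obtain ⟨v, hv⟩ : ∃ v, v ∉ W := by
      by_contra! h
      have : W = ⊤ := (Submodule.eq_top_iff' ).2 h
      rw [this, finrank_top] at hW
      omega
    exact ⟨W ⊔ Submodule.span K {v}, hPW.trans le_sup_left, by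
      rw [Submodule.finrank_sup_span_singleton hv, hW]⟩

theorem exists_le_finrank_eq [FiniteDimensional K V] (P : Submodule K V) {k : ℕ}
    (hk : k ≤ Module.finrank K P) : ∃ Q ≤ P, Module.finrank K Q = k := by
  obtain ⟨Q, -, hQ⟩ := superspaces_nonempty (⊥ : Submodule K P) (k := k) (by simp) hk
  exact ⟨Q.map P.subtype, Submodule.map_subtype_le _ _, by
    rw [Submodule.finrank_map_subtype_eq, hQ]⟩

theorem exists_linearEquiv_map_eq [FiniteDimensional K V] {P Q : Submodule K V}
    (h : Module.finrank K P = Module.finrank K Q) : ∃ e : V ≃ₗ[K] V, P.map e.toLinearMap = Q := by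
  obtain ⟨P', hP'⟩ := P.exists_isCompl
  obtain ⟨Q', hQ'⟩ := Q.exists_isCompl
  have h1 := Submodule.finrank_add_eq_of_isCompl hP'
  have h2 := Submodule.finrank_add_eq_of_isCompl hQ'
  let e₁ := LinearEquiv.ofFinrankEq P Q h
  let e₂ := LinearEquiv.ofFinrankEq (R := K) P' Q' (by omega)
  refine ⟨(P.prodEquivOfIsCompl P' hP').symm ≪≫ₗ (e₁.prodCongr e₂) ≪≫ₗ
    Q.prodEquivOfIsCompl Q' hQ', ?_⟩
  apply Submodule.eq_of_le_of_finrank_eq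
  · rintro _ ⟨x, hx, rfl⟩
    lift x to P using hx
    simp
  · rw [LinearEquiv.finrank_map_eq, h]

theorem ncard_superspaces_congr [FiniteDimensional K V] {P Q : Submodule K V}
    (h : Module.finrank K P = Module.finrank K Q) (k : ℕ) :
    (superspaces P k).ncard = (superspaces Q k).ncard := by
  obtain ⟨e, rfl⟩ := exists_linearEquiv_map_eq h
  refine Set.ncard_congr (fun W _ => W.map e.toLinearMap) ?_ ?_ ?_
  · rintro W ⟨hW, rfl⟩
    exact ⟨Submodule.map_mono hW, LinearEquiv.finrank_map_eq e W⟩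
  · intro W W' _ _ hWW
    exact Submodule.map_injective_of_injective e.injective hWW
  · rintro W ⟨hW, rfl⟩
    refine ⟨W.map e.symm.toLinearMap, ⟨?_, LinearEquiv.finrank_map_eq e.symm W⟩, ?_⟩
    · intro x hx
      exact ⟨e x, hW ⟨x, hx, rfl⟩, by simp⟩
    · ext x
      simp

theorem ncard_superspaces_mul [Fintype K] [Finite V] {P Q : Submodule K V}
    (h : Module.finrank K Q = Module.finrank K P + 1) (k : ℕ) :
    (superspaces P k).ncard * (Fintype.card K ^ k - Fintype.card K ^ Module.finrank K P) =
      (superspaces Q k).ncard *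
        (Fintype.card K ^ Module.finrank K V - Fintype.card K ^ Module.finrank K P) := by
  classical
  have := Fintype.ofFinite V
  have := Fintype.ofFinite (Submodule K V)
  have hcard : ∀ W : Submodule K V, P ≤ W →
      (Finset.univ.filter fun v => v ∈ W ∧ v ∉ P).card =
        Fintype.card K ^ Module.finrank K W - Fintype.card K ^ Module.finrank K P := by
    intro W hW
    have h1 : ∀ W : Submodule K V, (Finset.univ.filter fun v => v ∈ W).card =
        Fintype.card K ^ Module.finrank K W := by
      intro W
      rw [← Module.card_eq_pow_finrank (K := K) (V := W), Fintype.card_subtype]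
    rw [← h1, ← h1, ← Finset.card_sdiff_of_subset]
    · congr 1
      ext v
      simp
    · intro v
      simpa using fun hv => hW hv
  have key := Finset.sum_card_bipartiteAbove_eq_sum_card_bipartiteBelow
    (s := (superspaces P k).toFinset) (t := Finset.univ.filter fun v => v ∉ P)
    (fun W v => v ∈ W)
  rw [Finset.sum_const_nat (m := Fintype.card K ^ k - Fintype.card K ^ Module.finrank K P),
    Finset.sum_const_nat (m := (superspaces Q k).ncard)] at key
  · have ht := hcard ⊤ le_top
    simp only [Submodule.mem_top, true_and, finrank_top] at ht
    rw [ht, ← Set.ncard_eq_toFinset_card'] at key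
    rw [key, mul_comm]
  · intro v hv
    have hv : v ∉ P := by simpa using hv
    rw [ncard_superspaces_congr (h.trans (Submodule.finrank_sup_span_singleton hv).symm),
      Set.ncard_eq_toFinset_card']
    congr 1
    ext W
    simp only [Finset.bipartiteBelow, Finset.mem_filter, Set.mem_toFinset, mem_superspaces,
      sup_le_iff, Submodule.span_singleton_le_iff_mem]
    tauto
  · intro W hW
    obtain ⟨hPW, hWk⟩ : P ≤ W ∧ Module.finrank K W = k := by
      rwa [Set.mem_toFinset, mem_superspaces] at hW
    rw [← hWk, ← hcard W hPW]
    congr 1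
    ext v
    simp [Finset.bipartiteAbove, and_comm]

end Subspaces

section Flats

variable {𝔽 : Type} [Field 𝔽] {n : ℕ}

/-- The coset `x + P`. -/
def coset (P : Submodule 𝔽 (Fin n → 𝔽)) (x : Fin n → 𝔽) : Set (Fin n → 𝔽) :=
  {v | v - x ∈ P}

theorem mem_coset {P : Submodule 𝔽 (Fin n → 𝔽)} {x v : Fin n → 𝔽} :
    v ∈ coset P x ↔ v - x ∈ P := Iff.rfl

theorem coset_eq_of_mem {P : Submodule 𝔽 (Fin n → 𝔽)} {x y : Fin n → 𝔽} (h : y ∈ coset P x) :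
    coset P x = coset P y := by
  ext v
  rw [mem_coset, mem_coset, ← sub_add_sub_cancel v y x]
  exact P.add_mem_iff_left h

theorem coset_subset_coset {P Q : Submodule 𝔽 (Fin n → 𝔽)} {x : Fin n → 𝔽} :
    coset P x ⊆ coset Q x ↔ P ≤ Q := by
  refine ⟨fun h v hv => ?_, fun h v hv => h hv⟩
  have := @h (v + x) (by simpa [mem_coset] using hv)
  simpa [mem_coset] using this

theorem coset_inj {P Q : Submodule 𝔽 (Fin n → 𝔽)} {x : Fin n → 𝔽} :
    coset P x = coset Q x ↔ P = Q := by
  rw [subset_antisymm_iff, coset_subset_coset, coset_subset_coset, le_antisymm_iff]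

theorem isFlat_coset {P : Submodule 𝔽 (Fin n → 𝔽)} {x : Fin n → 𝔽} {k : ℕ} :
    IsFlat 𝔽 k (coset P x) ↔ Module.finrank 𝔽 P = k := by
  refine ⟨?_, fun h => ⟨P, x, h, rfl⟩⟩
  rintro ⟨Q, y, rfl, h⟩
  change coset P x = coset Q y at h
  have hx : x ∈ coset Q y := by simp [← h, mem_coset]
  rw [coset_eq_of_mem hx, coset_inj] at h
  rw [h]

theorem IsFlat.exists_coset {k : ℕ} {A : Set (Fin n → 𝔽)} (h : IsFlat 𝔽 k A) {x : Fin n → 𝔽}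
    (hx : x ∈ A) : ∃ P : Submodule 𝔽 (Fin n → 𝔽), Module.finrank 𝔽 P = k ∧ A = coset P x := by
  obtain ⟨P, y, hP, rfl⟩ := h
  exact ⟨P, hP, coset_eq_of_mem hx⟩

theorem IsFlat.nonempty {k : ℕ} {A : Set (Fin n → 𝔽)} (h : IsFlat 𝔽 k A) : A.Nonempty := by
  obtain ⟨P, y, hP, rfl⟩ := h
  exact ⟨y, by simp⟩

theorem IsFlat.le_of_subset {j k : ℕ} {A B : Set (Fin n → 𝔽)} (hA : IsFlat 𝔽 j A)
    (hB : IsFlat 𝔽 k B) (h : A ⊆ B) : j ≤ k := by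
  obtain ⟨x, hx⟩ := hA.nonempty
  obtain ⟨P, rfl, rfl⟩ := hA.exists_coset hx
  obtain ⟨Q, rfl, rfl⟩ := hB.exists_coset (h hx)
  exact Submodule.finrank_mono (coset_subset_coset.1 h)

theorem IsFlat.eq_of_subset {k : ℕ} {A B : Set (Fin n → 𝔽)} (hA : IsFlat 𝔽 k A)
    (hB : IsFlat 𝔽 k B) (h : A ⊆ B) : A = B := by
  obtain ⟨x, hx⟩ := hA.nonempty
  obtain ⟨P, rfl, rfl⟩ := hA.exists_coset hx
  obtain ⟨Q, hQ, rfl⟩ := hB.exists_coset (h hx)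
  exact coset_inj.2 (Submodule.eq_of_le_of_finrank_eq (coset_subset_coset.1 h) hQ.symm)

theorem IsFlat.exists_inter {j k : ℕ} {A B : Set (Fin n → 𝔽)} (hA : IsFlat 𝔽 j A)
    (hB : IsFlat 𝔽 k B) (h : (A ∩ B).Nonempty) : ∃ m, IsFlat 𝔽 m (A ∩ B) := by
  obtain ⟨x, hx⟩ := h
  obtain ⟨P, -, rfl⟩ := hA.exists_coset hx.1
  obtain ⟨Q, -, rfl⟩ := hB.exists_coset hx.2
  exact ⟨_, P ⊓ Q, x, rfl, rfl⟩

theorem IsFlat.exists_subset {k : ℕ} {A : Set (Fin n → 𝔽)} (hA : IsFlat 𝔽 (k + 1) A) :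
    ∃ T ⊆ A, IsFlat 𝔽 k T := by
  obtain ⟨P, x, hP, rfl⟩ := hA
  obtain ⟨Q, hQP, hQ⟩ := exists_le_finrank_eq P (k := k) (by omega)
  exact ⟨coset Q x, coset_subset_coset.2 hQP, isFlat_coset.2 hQ⟩

theorem ncard_A3_coset (P : Submodule 𝔽 (Fin n → 𝔽)) (x : Fin n → 𝔽) (k : ℕ) :
    (A3 𝔽 (coset P x) k).ncard = (superspaces P k).ncard := by
  symm
  refine Set.ncard_congr (fun W _ => coset W x) ?_ ?_ ?_
  · rintro W ⟨hW, hk⟩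
    exact ⟨isFlat_coset.2 hk, coset_subset_coset.2 hW⟩
  · intro W W' _ _ hWW
    exact coset_inj.1 hWW
  · rintro F ⟨hF, hPF⟩
    obtain ⟨W, hW, rfl⟩ := hF.exists_coset (hPF (by simp [mem_coset] : x ∈ coset P x))
    exact ⟨W, ⟨coset_subset_coset.1 hPF, hW⟩, rfl⟩

theorem A3_subset_A3 {S T : Set (Fin n → 𝔽)} (h : T ⊆ S) (k : ℕ) : A3 𝔽 S k ⊆ A3 𝔽 T k :=
  fun _ hF => ⟨hF.1, h.trans hF.2⟩

theorem A3_subset_A4 {S : Set (Fin n → 𝔽)} {t : ℕ} (hS : IsFlat 𝔽 (t + 1) S) (k : ℕ) :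
    A3 𝔽 S k ⊆ A4 𝔽 S k t :=
  fun _ hF => ⟨hF.1, t + 1, by omega, by rwa [inter_eq_self_of_subset_right hF.2]⟩

/-- A flat in `A₄(S; k, t)` not containing the `(t + 1)`-flat `S` meets `S` in a `t`-flat. -/
theorem mem_A4_diff_A3_inter_eq_iff {S T F : Set (Fin n → 𝔽)} {t k : ℕ}
    (hS : IsFlat 𝔽 (t + 1) S) (hT : IsFlat 𝔽 t T) (hTS : T ⊆ S) :
    (F ∈ A4 𝔽 S k t \ A3 𝔽 S k ∧ F ∩ S = T) ↔ F ∈ A3 𝔽 T k \ A3 𝔽 S k := by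
  constructor
  · rintro ⟨⟨hF, hFS⟩, rfl⟩
    exact ⟨⟨hF.1, inter_subset_left⟩, hFS⟩
  · rintro ⟨⟨hF, hTF⟩, hFS⟩
    have hsub : T ⊆ F ∩ S := subset_inter hTF hTS
    obtain ⟨m, hm⟩ := hF.exists_inter hS (hT.nonempty.mono hsub)
    have h1 := hT.le_of_subset hm hsub
    have h2 := hm.le_of_subset hS inter_subset_right
    have h3 : m ≠ t + 1 := by
      rintro rfl
      exact hFS ⟨hF, inter_eq_right.1 (hm.eq_of_subset hS inter_subset_right)⟩
    obtain rfl : m = t := by omega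
    exact ⟨⟨⟨hF, m, le_rfl, hm⟩, hFS⟩, (hT.eq_of_subset hm hsub).symm⟩

theorem isFlat_inter_of_mem_A4_diff_A3 {S F : Set (Fin n → 𝔽)} {t k : ℕ}
    (hS : IsFlat 𝔽 (t + 1) S) (hF : F ∈ A4 𝔽 S k t \ A3 𝔽 S k) : IsFlat 𝔽 t (F ∩ S) := by
  obtain ⟨⟨hF, j, hj, hFj⟩, hFS⟩ := hF
  have h2 := hFj.le_of_subset hS inter_subset_right
  have h3 : j ≠ t + 1 := by
    rintro rfl
    exact hFS ⟨hF, inter_eq_right.1 (hFj.eq_of_subset hS inter_subset_right)⟩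
  obtain rfl : j = t := by omega
  exact hFj

open Classical in
theorem ncard_A4 [Fintype 𝔽] {S : Set (Fin n → 𝔽)} {t : ℕ} (hS : IsFlat 𝔽 (t + 1) S) (k : ℕ) :
    (A4 𝔽 S k t).ncard = (A3 𝔽 S k).ncard +
      ∑ T : Set (Fin n → 𝔽) with IsFlat 𝔽 t T ∧ T ⊆ S, (A3 𝔽 T k \ A3 𝔽 S k).ncard := by
  rw [← Set.ncard_sdiff_add_ncard_of_subset (A3_subset_A4 hS k), add_comm,
    Set.ncard_eq_toFinset_card' (A4 𝔽 S k t \ A3 𝔽 S k),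
    Finset.card_eq_sum_card_fiberwise (f := fun F => F ∩ S)
      (t := Finset.univ.filter fun T => IsFlat 𝔽 t T ∧ T ⊆ S)]
  · congr 1
    refine Finset.sum_congr rfl fun T hT => ?_
    obtain ⟨hT, hTS⟩ : IsFlat 𝔽 t T ∧ T ⊆ S := by simpa using hT
    rw [Set.ncard_eq_toFinset_card']
    refine congrArg Finset.card (Finset.ext fun F => ?_)
    rw [Finset.mem_filter, Set.mem_toFinset, Set.mem_toFinset,
      mem_A4_diff_A3_inter_eq_iff hS hT hTS]
  · intro F hF
    rw [Set.coe_toFinset] at hF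
    rw [Finset.mem_coe, Finset.mem_filter]
    exact ⟨Finset.mem_univ _, isFlat_inter_of_mem_A4_diff_A3 hS hF, inter_subset_right⟩

theorem ncard_A3_pos [Finite 𝔽] {S : Set (Fin n → 𝔽)} {j k : ℕ} (hS : IsFlat 𝔽 j S)
    (hj : j ≤ k) (hk : k ≤ n) : 0 < (A3 𝔽 S k).ncard := by
  obtain ⟨P, x, hP, rfl⟩ := hS
  change 0 < (A3 𝔽 (coset P x) k).ncard
  rw [ncard_A3_coset, Set.ncard_pos]
  exact superspaces_nonempty P (hP ▸ hj) (by simpa using hk)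

theorem ncard_A3_mul [Fintype 𝔽] {S T : Set (Fin n → 𝔽)} {t : ℕ} (hT : IsFlat 𝔽 t T)
    (hS : IsFlat 𝔽 (t + 1) S) (k : ℕ) :
    (A3 𝔽 T k).ncard * (Fintype.card 𝔽 ^ k - Fintype.card 𝔽 ^ t) =
      (A3 𝔽 S k).ncard * (Fintype.card 𝔽 ^ n - Fintype.card 𝔽 ^ t) := by
  obtain ⟨P, x, hP, rfl⟩ := hT
  obtain ⟨Q, y, hQ, rfl⟩ := hS
  have := ncard_superspaces_mul (P := P) (Q := Q) (by omega) k
  rw [hP, Module.finrank_fin_fun, ← ncard_A3_coset P x, ← ncard_A3_coset Q y] at this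
  exact this

theorem ncard_A3_mul_lt [Fintype 𝔽] {S T : Set (Fin n → 𝔽)} {t k₁ k₂ : ℕ}
    (hT : IsFlat 𝔽 t T) (hS : IsFlat 𝔽 (t + 1) S) (hk : k₂ < k₁) (hk₂ : t + 1 ≤ k₂)
    (hk₁ : k₁ ≤ n) :
    (A3 𝔽 S k₂).ncard * (A3 𝔽 T k₁).ncard < (A3 𝔽 S k₁).ncard * (A3 𝔽 T k₂).ncard := by
  have e₁ := ncard_A3_mul hT hS k₁
  have e₂ := ncard_A3_mul hT hS k₂
  have hq := Fintype.one_lt_card (α := 𝔽)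
  have h₁ : Fintype.card 𝔽 ^ t < Fintype.card 𝔽 ^ k₂ := Nat.pow_lt_pow_right hq hk₂
  have h₂ : Fintype.card 𝔽 ^ k₂ < Fintype.card 𝔽 ^ k₁ := Nat.pow_lt_pow_right hq hk
  have p₁ := ncard_A3_pos hS (by omega : t + 1 ≤ k₁) hk₁
  have p₂ := ncard_A3_pos hT (by omega : t ≤ k₂) (by omega)
  set d₁ := Fintype.card 𝔽 ^ k₁ - Fintype.card 𝔽 ^ t
  set d₂ := Fintype.card 𝔽 ^ k₂ - Fintype.card 𝔽 ^ t
  have hd : d₂ < d₁ := by omega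
  refine lt_of_mul_lt_mul_right (a := d₁) ?_ (Nat.zero_le _)
  calc (A3 𝔽 S k₂).ncard * (A3 𝔽 T k₁).ncard * d₁
      = (A3 𝔽 S k₁).ncard * (A3 𝔽 T k₂).ncard * d₂ := by
        rw [mul_assoc, e₁, mul_assoc, e₂]
        ring
    _ < _ := Nat.mul_lt_mul_of_pos_left hd (Nat.mul_pos p₁ p₂)

end Flats

theorem stmt_17 (q : ℕ) (hq : IsPrimePow q)
    (𝔽 : Type) [Field 𝔽] [Fintype 𝔽] (hcard : Fintype.card 𝔽 = q)
    (n k1 k2 t : ℕ) (ht : 0 < t) (hn : k1 + k2 + t + 3 ≤ n)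
    (hk12 : k2 < k1) (hk2 : t + 1 ≤ k2)
    (S : Set (Fin n → 𝔽)) (hS : IsFlat 𝔽 (t + 1) S) :
    (A3 𝔽 S k2).ncard * (A4 𝔽 S k1 t).ncard
      < (A3 𝔽 S k1).ncard * (A4 𝔽 S k2 t).ncard := by
  classical
  rw [ncard_A4 hS k1, ncard_A4 hS k2, mul_add, mul_add, Finset.mul_sum, Finset.mul_sum,
    mul_comm (A3 𝔽 S k2).ncard (A3 𝔽 S k1).ncard]
  refine Nat.add_lt_add_left (Finset.sum_lt_sum_of_nonempty ?_ ?_) _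
  · obtain ⟨T, hTS, hT⟩ := hS.exists_subset
    exact ⟨T, by simpa using ⟨hT, hTS⟩⟩
  · intro T hT
    obtain ⟨hT, hTS⟩ : IsFlat 𝔽 t T ∧ T ⊆ S := by simpa using hT
    have h₁ := Set.ncard_sdiff_add_ncard_of_subset (A3_subset_A3 hTS k1)
    have h₂ := Set.ncard_sdiff_add_ncard_of_subset (A3_subset_A3 hTS k2)
    have h := ncard_A3_mul_lt hT hS hk12 hk2 (by omega)
    rw [← h₁, ← h₂] at h
    linarith
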